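/- arXiv:1709.05132 — 3 statements merged into one kernel-verified Lean document; each statement's English description precedes it below -/
import Mathlib

section
/- Let A, Ã ∈ ℝ^{N×N} be nonnegative matrices agreeing outside a set of perturbed edges δE, with source set S and tip set T. Then for all indices k, ℓ and every real polynomial p whose degree is at most dist_A(k,S) + dist_A(T,ℓ), one has (p(A))_{kℓ} = (p(Ã))_{kℓ}; in particular (A^n)_{kℓ} = (Ã^n)_{kℓ} for every natural number n ≤ dist_A(k,S) + dist_A(T,ℓ). -/
open Matrix

/-- A walk of length `n` from `k` to `l` in the weighted directed graph determined
by the matrix `A` (an edge from `i` to `j` exists iff `A i j > 0`). -/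
def IsWalk {N : ℕ} (A : Matrix (Fin N) (Fin N) ℝ) (k l : Fin N) (n : ℕ) : Prop :=
  ∃ u : ℕ → Fin N, u 0 = k ∧ u n = l ∧ ∀ i < n, 0 < A (u i) (u (i + 1))

/-- The geodesic (shortest-path) distance from `k` to `l` in the graph of `A`,
with value `⊤` if there is no walk from `k` to `l`. -/
noncomputable def distA {N : ℕ} (A : Matrix (Fin N) (Fin N) ℝ) (k l : Fin N) : ℕ∞ :=
  ⨅ n ∈ {n : ℕ | IsWalk A k l n}, (n : ℕ∞)

/-- Distance from a node `k` to a set of nodes `S`. -/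
noncomputable def distToSet {N : ℕ} (A : Matrix (Fin N) (Fin N) ℝ) (k : Fin N)
    (S : Set (Fin N)) : ℕ∞ := ⨅ s ∈ S, distA A k s

/-- Distance from a set of nodes `S` to a node `l`. -/
noncomputable def distFromSet {N : ℕ} (A : Matrix (Fin N) (Fin N) ℝ) (S : Set (Fin N))
    (l : Fin N) : ℕ∞ := ⨅ s ∈ S, distA A s l

/-- A nonzero entry of a power of a nonnegative matrix is witnessed by a walk. -/
theorem isWalk_of_pow_apply_ne_zero {N : ℕ} {A : Matrix (Fin N) (Fin N) ℝ}
    (hA : ∀ i j, 0 ≤ A i j) {k : Fin N} :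
    ∀ {n : ℕ} {l : Fin N}, (A ^ n) k l ≠ 0 → IsWalk A k l n := by
  intro n
  induction n with
  | zero =>
    intro l h
    have hkl : k = l := by
      by_contra hne
      exact h (by simp [Matrix.one_apply_ne hne])
    exact ⟨fun _ => k, rfl, hkl, by simp⟩
  | succ n ih =>
    intro l h
    rw [pow_succ, Matrix.mul_apply] at h
    obtain ⟨s, -, hs⟩ := Finset.exists_ne_zero_of_sum_ne_zero h
    obtain ⟨u, hu0, hun, hu⟩ := ih (left_ne_zero_of_mul hs)
    refine ⟨fun m => if m ≤ n then u m else l, by simpa using hu0, by simp, fun i hi => ?_⟩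
    rcases Nat.lt_succ_iff_lt_or_eq.mp hi with hi | rfl
    · simpa [hi.le, Nat.succ_le_of_lt hi] using hu i hi
    · simpa [hun] using lt_of_le_of_ne (hA s l) (right_ne_zero_of_mul hs).symm

theorem pow_apply_eq_zero_of_lt_distA {N : ℕ} {A : Matrix (Fin N) (Fin N) ℝ}
    (hA : ∀ i j, 0 ≤ A i j) {k l : Fin N} {n : ℕ} (h : (n : ℕ∞) < distA A k l) :
    (A ^ n) k l = 0 := by
  by_contra hne
  exact h.not_ge (iInf₂_le n (isWalk_of_pow_apply_ne_zero hA hne))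

theorem pow_apply_eq_of_le_distToSet {N : ℕ} {A B : Matrix (Fin N) (Fin N) ℝ}
    (hA : ∀ i j, 0 ≤ A i j) {S : Set (Fin N)} (hS : ∀ i j, i ∉ S → A i j = B i j)
    {k : Fin N} {n : ℕ} (h : (n : ℕ∞) ≤ distToSet A k S) (j : Fin N) :
    (A ^ n) k j = (B ^ n) k j := by
  induction n generalizing j with
  | zero => simp
  | succ n ih =>
    have hlt : (n : ℕ∞) < distToSet A k S :=
      lt_of_lt_of_le (by exact_mod_cast n.lt_succ_self) h
    rw [pow_succ, pow_succ, Matrix.mul_apply, Matrix.mul_apply]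
    refine Finset.sum_congr rfl fun s _ => ?_
    rw [← ih hlt.le s]
    by_cases hs : s ∈ S
    · simp [pow_apply_eq_zero_of_lt_distA hA (hlt.trans_le (iInf₂_le s hs))]
    · rw [hS s j hs]

theorem pow_apply_eq_of_le_distFromSet {N : ℕ} {A B : Matrix (Fin N) (Fin N) ℝ}
    (hA : ∀ i j, 0 ≤ A i j) {T : Set (Fin N)} (hT : ∀ i j, j ∉ T → A i j = B i j)
    {l : Fin N} {n : ℕ} (h : (n : ℕ∞) ≤ distFromSet A T l) (i : Fin N) :
    (A ^ n) i l = (B ^ n) i l := by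
  induction n generalizing i with
  | zero => simp
  | succ n ih =>
    have hlt : (n : ℕ∞) < distFromSet A T l :=
      lt_of_lt_of_le (by exact_mod_cast n.lt_succ_self) h
    rw [pow_succ', pow_succ', Matrix.mul_apply, Matrix.mul_apply]
    refine Finset.sum_congr rfl fun t _ => ?_
    rw [← ih hlt.le t]
    by_cases ht : t ∈ T
    · simp [pow_apply_eq_zero_of_lt_distA hA (hlt.trans_le (iInf₂_le t ht))]
    · rw [hT i t ht]

theorem exists_add_eq_of_natCast_le_add {n : ℕ} {a b : ℕ∞} (h : (n : ℕ∞) ≤ a + b) :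
    ∃ i j : ℕ, i + j = n ∧ (i : ℕ∞) ≤ a ∧ (j : ℕ∞) ≤ b := by
  rcases le_total (n : ℕ∞) a with hn | hn
  · exact ⟨n, 0, rfl, hn, by simp⟩
  · lift a to ℕ using ne_top_of_le_ne_top (ENat.natCast_ne_top n) hn
    have hn' : a ≤ n := by exact_mod_cast hn
    refine ⟨a, n - a, by omega, le_rfl, ?_⟩
    rw [← Nat.add_sub_cancel' hn', Nat.cast_add] at h
    exact (ENat.add_le_add_iff_left (ENat.natCast_ne_top a)).mp h

/-- If the nonnegative matrices `A` and `B` agree outside the perturbed edge set `δE`,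
with sources `S` and tips `T`, then for all `k, l` and every real polynomial `p` of
degree at most `distA(k,S) + distA(T,l)` one has `(p(A)) k l = (p(B)) k l`;
in particular `(A ^ n) k l = (B ^ n) k l` for every `n ≤ distA(k,S) + distA(T,l)`. -/
theorem aeval_entry_eq_of_natDegree_le_dist {N : ℕ}
    (A B : Matrix (Fin N) (Fin N) ℝ)
    (hA : ∀ i j, 0 ≤ A i j) (hB : ∀ i j, 0 ≤ B i j)
    (δE : Set (Fin N × Fin N))
    (hagree : ∀ i j, (i, j) ∉ δE → A i j = B i j)
    (k l : Fin N) :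
    (∀ p : Polynomial ℝ,
      (p.natDegree : ℕ∞) ≤ distToSet A k {s | ∃ t, (s, t) ∈ δE} +
        distFromSet A {t | ∃ s, (s, t) ∈ δE} l →
      (Polynomial.aeval A p) k l = (Polynomial.aeval B p) k l) ∧
    (∀ n : ℕ,
      (n : ℕ∞) ≤ distToSet A k {s | ∃ t, (s, t) ∈ δE} +
        distFromSet A {t | ∃ s, (s, t) ∈ δE} l →
      (A ^ n) k l = (B ^ n) k l) := by
  have hS : ∀ i j, i ∉ {s | ∃ t, (s, t) ∈ δE} → A i j = B i j :=
    fun i j hi => hagree i j fun h => hi ⟨j, h⟩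
  have hT : ∀ i j, j ∉ {t | ∃ s, (s, t) ∈ δE} → A i j = B i j :=
    fun i j hj => hagree i j fun h => hj ⟨i, h⟩
  have hpow : ∀ n : ℕ,
      (n : ℕ∞) ≤ distToSet A k {s | ∃ t, (s, t) ∈ δE} +
        distFromSet A {t | ∃ s, (s, t) ∈ δE} l →
      (A ^ n) k l = (B ^ n) k l := by
    intro n hn
    obtain ⟨i, j, rfl, hi, hj⟩ := exists_add_eq_of_natCast_le_add hn
    rw [pow_add, pow_add, Matrix.mul_apply, Matrix.mul_apply]
    refine Finset.sum_congr rfl fun s _ => ?_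
    rw [pow_apply_eq_of_le_distToSet hA hS hi s,
      pow_apply_eq_of_le_distFromSet hA hT hj s]
  refine ⟨fun p hp => ?_, hpow⟩
  simp only [Polynomial.aeval_eq_sum_range, Matrix.sum_apply, Matrix.smul_apply]
  refine Finset.sum_congr rfl fun n hn => ?_
  rw [hpow n (le_trans (by exact_mod_cast Finset.mem_range_succ_iff.mp hn) hp)]
end

section
/- Let A, Ã ∈ ℝ^{N×N} be symmetric nonnegative matrices and S ⊆ {1,…,N} a set of vertices such that A_{ij} = Ã_{ij} whenever i ∉ S or j ∉ S (i.e. only edges between nodes of S are modified). Assume all row sums d_i = Σ_j A_{ij} and d̃_i = Σ_j Ã_{ij} are positive, and let 𝒜 = D^{−1/2} A D^{−1/2} and 𝒜̃ = D̃^{−1/2} Ã D̃^{−1/2} be the normalized adjacency matrices, where D = diag(d_1,…,d_N) and D̃ = diag(d̃_1,…,d̃_N). Then for all indices k, ℓ ∉ S and every real polynomial p of degree at most dist_A(k,S) + dist_A(S,ℓ) − 1, one has (p(𝒜))_{kℓ} = (p(𝒜̃))_{kℓ}. -/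
open Matrix

theorem IsWalk.cons {N : ℕ} {A : Matrix (Fin N) (Fin N) ℝ} {k u l : Fin N} {n : ℕ}
    (hku : 0 < A k u) (h : IsWalk A u l n) : IsWalk A k l (n + 1) := by
  obtain ⟨w, h0, hn, hw⟩ := h
  refine ⟨fun i => Nat.casesOn i k w, rfl, hn, fun i hi => ?_⟩
  cases i with
  | zero => simpa [h0] using hku
  | succ i => exact hw i (by omega)

theorem IsWalk.refl {N : ℕ} (A : Matrix (Fin N) (Fin N) ℝ) (k : Fin N) : IsWalk A k k 0 :=
  ⟨fun _ => k, rfl, rfl, fun _ hi => absurd hi (Nat.not_lt_zero _)⟩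

theorem distA_le {N : ℕ} {A : Matrix (Fin N) (Fin N) ℝ} {k l : Fin N} {n : ℕ}
    (h : IsWalk A k l n) : distA A k l ≤ n :=
  iInf₂_le n h

theorem distToSet_le {N : ℕ} {A : Matrix (Fin N) (Fin N) ℝ} {S : Set (Fin N)}
    {k s : Fin N} {n : ℕ} (hs : s ∈ S) (h : IsWalk A k s n) : distToSet A k S ≤ n :=
  (iInf₂_le s hs).trans (distA_le h)

theorem distFromSet_le {N : ℕ} {A : Matrix (Fin N) (Fin N) ℝ} {S : Set (Fin N)}
    {s l : Fin N} {n : ℕ} (hs : s ∈ S) (h : IsWalk A s l n) : distFromSet A S l ≤ n :=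
  (iInf₂_le s hs).trans (distA_le h)

/-- If `M` is supported on the edges of `A` and on `S × S`, then a nonzero entry of `M ^ n` comes
from a walk in `A`, possibly only after its last visit to `S`. -/
theorem exists_isWalk_of_pow_ne_zero {N : ℕ} {A M : Matrix (Fin N) (Fin N) ℝ} {S : Set (Fin N)}
    (hM : ∀ i j, M i j ≠ 0 → 0 < A i j ∨ j ∈ S) {l : Fin N} (n : ℕ) (u : Fin N)
    (h : (M ^ n) u l ≠ 0) :
    IsWalk A u l n ∨ ∃ s ∈ S, ∃ j ≤ n, IsWalk A s l j := by
  induction n generalizing u with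
  | zero =>
    have hul : u = l := by
      by_contra hne
      exact h (by simp [hne])
    exact Or.inl (hul ▸ IsWalk.refl A u)
  | succ n ih =>
    rw [pow_succ', Matrix.mul_apply] at h
    obtain ⟨v, -, hv⟩ := Finset.exists_ne_zero_of_sum_ne_zero h
    rcases ih v (right_ne_zero_of_mul hv) with hw | ⟨s, hs, j, hj, hw⟩
    · rcases hM u v (left_ne_zero_of_mul hv) with huv | hvS
      · exact Or.inl (hw.cons huv)
      · exact Or.inr ⟨v, hvS, n, n.le_succ, hw⟩
    · exact Or.inr ⟨s, hs, j, hj.trans n.le_succ, hw⟩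

theorem pow_apply_eq_zero_of_mem {N : ℕ} {A M : Matrix (Fin N) (Fin N) ℝ} {S : Set (Fin N)}
    (hM : ∀ i j, M i j ≠ 0 → 0 < A i j ∨ j ∈ S) {l : Fin N} {b n : ℕ}
    (hb : ∀ s ∈ S, ∀ j, IsWalk A s l j → b ≤ j) (hn : n < b) {u : Fin N} (hu : u ∈ S) :
    (M ^ n) u l = 0 := by
  by_contra h
  rcases exists_isWalk_of_pow_ne_zero hM n u h with hw | ⟨s, hs, j, hj, hw⟩
  · exact absurd (hb u hu n hw) (by omega)
  · exact absurd (hb s hs j hw) (by omega)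

/-- Two matrices supported on the edges of `A` and on `S × S`, which agree off `S`, have powers
that agree on pairs whose connecting walks through `S` are too long. -/
theorem pow_apply_eq_of_lt {N : ℕ} {A M M' : Matrix (Fin N) (Fin N) ℝ} {S : Set (Fin N)}
    (hM : ∀ i j, M i j ≠ 0 → 0 < A i j ∨ i ∈ S ∧ j ∈ S)
    (hM' : ∀ i j, M' i j ≠ 0 → 0 < A i j ∨ i ∈ S ∧ j ∈ S)
    (hMM' : ∀ i j, i ∉ S → j ∉ S → M i j = M' i j) {l : Fin N} {b : ℕ}
    (hb : ∀ s ∈ S, ∀ j, IsWalk A s l j → b ≤ j) (n a : ℕ) (k : Fin N) (hk : k ∉ S)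
    (ha : ∀ s ∈ S, ∀ i, IsWalk A k s i → a ≤ i) (hn : n < a + b) :
    (M ^ n) k l = (M' ^ n) k l := by
  induction n generalizing a k with
  | zero => simp
  | succ n ih =>
    rw [pow_succ', pow_succ', Matrix.mul_apply, Matrix.mul_apply]
    refine Finset.sum_congr rfl fun u _ => ?_
    by_cases hku : 0 < A k u
    · by_cases hu : u ∈ S
      · have ha1 : a ≤ 1 := ha u hu 1 ((IsWalk.refl A u).cons hku)
        rw [pow_apply_eq_zero_of_mem (fun i j h => (hM i j h).imp_right And.right) hb
            (by omega) hu,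
          pow_apply_eq_zero_of_mem (fun i j h => (hM' i j h).imp_right And.right) hb
            (by omega) hu, mul_zero, mul_zero]
      · rw [hMM' k u hk hu, ih (a - 1) u hu (fun s hs i hw => ?_) (by omega)]
        have := ha s hs _ (hw.cons hku)
        omega
    · have h0 : M k u = 0 := by
        by_contra h
        exact (hM k u h).elim hku fun h => hk h.1
      have h0' : M' k u = 0 := by
        by_contra h
        exact (hM' k u h).elim hku fun h => hk h.1
      rw [h0, h0', zero_mul, zero_mul]

theorem ENat.exists_lt_add_of_add_one_le {n : ℕ} {x y : ℕ∞} (h : (n : ℕ∞) + 1 ≤ x + y) :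
    ∃ a b : ℕ, n < a + b ∧ (a : ℕ∞) ≤ x ∧ (b : ℕ∞) ≤ y := by
  induction x using ENat.recTopCoe with
  | top => exact ⟨n + 1, 0, by omega, le_top, zero_le⟩
  | coe a =>
    induction y using ENat.recTopCoe with
    | top => exact ⟨0, n + 1, by omega, zero_le, le_top⟩
    | coe b => exact ⟨a, b, by exact_mod_cast h, le_rfl, le_rfl⟩

/-- Normalized-adjacency stability (Lemma 5.8): if the symmetric nonnegative matrices
`A` and `B` agree on every entry `(i, j)` with `i ∉ S` or `j ∉ S` (only edges inside
`S` are modified), all row sums are positive, `𝒜 = D^{-1/2} A D^{-1/2}` and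
`𝒜' = D'^{-1/2} B D'^{-1/2}` are the normalized adjacency matrices, then for all
`k, l ∉ S` and every real polynomial `p` of degree at most
`distA(k,S) + distA(S,l) - 1` one has `(p(𝒜)) k l = (p(𝒜')) k l`. -/
theorem aeval_normalized_entry_eq {N : ℕ}
    (A B : Matrix (Fin N) (Fin N) ℝ)
    (hAsym : A.IsSymm) (hBsym : B.IsSymm)
    (hA : ∀ i j, 0 ≤ A i j) (hB : ∀ i j, 0 ≤ B i j)
    (S : Set (Fin N))
    (hagree : ∀ i j, i ∉ S ∨ j ∉ S → A i j = B i j)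
    (hd : ∀ i, 0 < ∑ j, A i j) (hd' : ∀ i, 0 < ∑ j, B i j)
    (k l : Fin N) (hk : k ∉ S) (hl : l ∉ S)
    (p : Polynomial ℝ)
    (hdeg : (p.natDegree : ℕ∞) + 1 ≤ distToSet A k S + distFromSet A S l) :
    (Polynomial.aeval
        (Matrix.diagonal (fun i => 1 / Real.sqrt (∑ j, A i j)) * A *
          Matrix.diagonal (fun i => 1 / Real.sqrt (∑ j, A i j))) p) k l =
    (Polynomial.aeval
        (Matrix.diagonal (fun i => 1 / Real.sqrt (∑ j, B i j)) * B *
          Matrix.diagonal (fun i => 1 / Real.sqrt (∑ j, B i j))) p) k l := by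
  obtain ⟨a, b, hab, ha, hb⟩ := ENat.exists_lt_add_of_add_one_le hdeg
  have hrow : ∀ i, i ∉ S → ∑ j, A i j = ∑ j, B i j := fun i hi =>
    Finset.sum_congr rfl fun j _ => hagree i j (Or.inl hi)
  rw [Polynomial.aeval_eq_sum_range, Polynomial.aeval_eq_sum_range, Matrix.sum_apply,
    Matrix.sum_apply]
  refine Finset.sum_congr rfl fun n hn => ?_
  rw [Finset.mem_range] at hn
  rw [Matrix.smul_apply, Matrix.smul_apply]
  congr 1
  refine pow_apply_eq_of_lt (A := A) (S := S) (b := b) ?_ ?_ ?_ ?_ n a k hk ?_ (by omega)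
  · intro i j h
    rw [Matrix.mul_diagonal, Matrix.diagonal_mul] at h
    exact Or.inl ((hA i j).lt_of_ne' (right_ne_zero_of_mul (left_ne_zero_of_mul h)))
  · intro i j h
    rw [Matrix.mul_diagonal, Matrix.diagonal_mul] at h
    by_cases hS : i ∈ S ∧ j ∈ S
    · exact Or.inr hS
    · left
      have hAB := hagree i j (not_and_or.mp hS)
      exact (hA i j).lt_of_ne' (hAB ▸ right_ne_zero_of_mul (left_ne_zero_of_mul h))
  · intro i j hi hj
    rw [Matrix.mul_diagonal, Matrix.diagonal_mul, Matrix.mul_diagonal, Matrix.diagonal_mul,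
      hrow i hi, hrow j hj, hagree i j (Or.inl hi)]
  · exact fun s hs j hw => by exact_mod_cast hb.trans (distFromSet_le hs hw)
  · exact fun s hs i hw => by exact_mod_cast ha.trans (distToSet_le hs hw)
end

section
/- Let ρ > 0, R > 0 and m > 0 be real numbers, define g : (0,∞) → ℝ by g(τ) = exp((ρ/2)(Rτ + 1/(Rτ))) · τ^{−m}, and set τ* = (m + √(m² + ρ²))/(ρR). Then g(τ*) ≤ g(τ) for every τ > 0, i.e. τ* is a global minimizer of g on (0,∞). Moreover, if m > (ρ/2)(R − 1/R), then τ* > 1. -/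
/-- The function `g(τ) = exp((ρ/2)(Rτ + 1/(Rτ))) · τ^{-m}` arising in the proof of
Corollary 5.5 (here `τ ^ (-m)` is the real power `Real.rpow`). -/
noncomputable def gFun (ρ R m τ : ℝ) : ℝ :=
  Real.exp (ρ / 2 * (R * τ + 1 / (R * τ))) * τ ^ (-m)

theorem gFun_eq_exp (ρ R m : ℝ) {τ : ℝ} (hτ : 0 < τ) :
    gFun ρ R m τ = Real.exp (ρ / 2 * (R * τ + 1 / (R * τ)) - m * Real.log τ) := by
  rw [gFun, Real.rpow_def_of_pos hτ, ← Real.exp_add]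
  congr 1
  ring

/-- A positive critical point of `gFun ρ R m` is a global minimizer on `(0, ∞)`. -/
theorem gFun_le_of_critical {ρ R m t τ : ℝ} (hρ : 0 < ρ) (hR : 0 < R) (ht : 0 < t)
    (hcrit : ρ / 2 * (R * t - 1 / (R * t)) = m) (hτ : 0 < τ) :
    gFun ρ R m t ≤ gFun ρ R m τ := by
  rw [gFun_eq_exp ρ R m ht, gFun_eq_exp ρ R m hτ, Real.exp_le_exp, ← hcrit]
  have h₁ : Real.log τ - Real.log t ≤ τ / t - 1 := by
    rw [← Real.log_div hτ.ne' ht.ne']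
    exact Real.log_le_sub_one_of_pos (div_pos hτ ht)
  have h₂ : Real.log t - Real.log τ ≤ t / τ - 1 := by
    rw [← Real.log_div ht.ne' hτ.ne']
    exact Real.log_le_sub_one_of_pos (div_pos ht hτ)
  have h₃ := mul_le_mul_of_nonneg_left h₁ (show 0 ≤ ρ / 2 * (R * t) by positivity)
  have h₄ := mul_le_mul_of_nonneg_left h₂ (show 0 ≤ ρ / 2 * (1 / (R * t)) by positivity)
  have e₁ : ρ / 2 * (R * t) * (τ / t - 1) = ρ / 2 * (R * τ) - ρ / 2 * (R * t) := by
    field_simp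
  have e₂ : ρ / 2 * (1 / (R * t)) * (t / τ - 1) =
      ρ / 2 * (1 / (R * τ)) - ρ / 2 * (1 / (R * t)) := by
    field_simp
  rw [e₁] at h₃
  rw [e₂] at h₄
  linarith

/-- Optimal choice of `τ` in the proof of Corollary 5.5: for `ρ, R, m > 0`, the point
`τ* = (m + √(m² + ρ²))/(ρR)` is a global minimizer of
`g(τ) = exp((ρ/2)(Rτ + 1/(Rτ))) τ^{-m}` on `(0, ∞)`; moreover, if
`m > (ρ/2)(R - 1/R)` then `τ* > 1`. -/
theorem gFun_min_at_tauStar (ρ R m : ℝ) (hρ : 0 < ρ) (hR : 0 < R) (hm : 0 < m) :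
    (∀ τ : ℝ, 0 < τ →
      gFun ρ R m ((m + Real.sqrt (m ^ 2 + ρ ^ 2)) / (ρ * R)) ≤ gFun ρ R m τ) ∧
    (ρ / 2 * (R - 1 / R) < m → 1 < (m + Real.sqrt (m ^ 2 + ρ ^ 2)) / (ρ * R)) := by
  have hsq : Real.sqrt (m ^ 2 + ρ ^ 2) ^ 2 = m ^ 2 + ρ ^ 2 := Real.sq_sqrt (by positivity)
  refine ⟨fun τ hτ => gFun_le_of_critical hρ hR (by positivity) ?_ hτ, fun h => ?_⟩
  · have hpos : 0 < m + Real.sqrt (m ^ 2 + ρ ^ 2) := by positivity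
    field_simp
    linear_combination hsq
  · rw [one_lt_div (by positivity), ← sub_lt_iff_lt_add']
    apply Real.lt_sqrt_of_sq_lt
    have hprod : ρ ^ 2 * (R ^ 2 - 1) < 2 * ρ * R * m := by
      have := mul_lt_mul_of_pos_left h (show 0 < 2 * ρ * R by positivity)
      have e : 2 * ρ * R * (ρ / 2 * (R - 1 / R)) = ρ ^ 2 * (R ^ 2 - 1) := by
        field_simp
      rwa [e] at this
    linarith
end
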